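/- arXiv:2306.14218 — 3 statements merged into one kernel-verified Lean document; each statement's English description precedes it below -/
import Mathlib

section
/- Let K be a compact subset of ℝⁿ and let g₁, g₂ : K → ℝ be nonnegative continuous functions such that {x ∈ K : g₂(x) = 0} ⊆ {x ∈ K : g₁(x) = 0}. Then there exists a continuous, strictly increasing function θ : [0,∞) → [0,∞) with θ(0) = 0 such that g₁(x) ≤ θ(g₂(x)) for all x ∈ K. -/
open Filter Topology in
lemma continuous_mul_abs_div_max {X : Type*} [TopologicalSpace X] {g₁ g₂ : X → ℝ}
    (hg₁ : Continuous g₁) (hg₂ : Continuous g₂) (hg₂0 : ∀ x, 0 ≤ g₂ x)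
    (hzero : ∀ x, g₂ x = 0 → g₁ x = 0) :
    Continuous fun p : ℝ × X => g₁ p.2 * (|p.1| / max (g₂ p.2) |p.1|) := by
  refine continuous_iff_continuousAt.2 fun ⟨s, x⟩ => ?_
  by_cases h : max (g₂ x) |s| = 0
  · have hx : g₁ x = 0 := hzero x (le_antisymm (h ▸ le_max_left _ _) (hg₂0 x))
    have hlim : Tendsto (fun p : ℝ × X => |g₁ p.2|) (𝓝 (s, x)) (𝓝 0) := by
      have : Continuous fun p : ℝ × X => |g₁ p.2| := by fun_prop
      simpa [hx] using this.tendsto (s, x)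
    rw [ContinuousAt]
    simp only [hx, zero_mul]
    refine squeeze_zero_norm (fun p => ?_) hlim
    have hp : 0 ≤ max (g₂ p.2) |p.1| := le_max_of_le_right (abs_nonneg _)
    rw [Real.norm_eq_abs, abs_mul, abs_div, abs_abs, abs_of_nonneg hp]
    exact mul_le_of_le_one_right (abs_nonneg _) (div_le_one_of_le₀ (le_max_right _ _) hp)
  · exact ContinuousAt.mul (by fun_prop) (ContinuousAt.div (by fun_prop) (by fun_prop) h)

lemma div_max_le_div_max {a s t : ℝ} (ha : 0 ≤ a) (hs : 0 ≤ s) (hst : s ≤ t) :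
    s / max a s ≤ t / max a t := by
  rcases hs.eq_or_lt with rfl | hs
  · simpa using div_nonneg hst (le_max_of_le_left ha)
  · rw [div_le_div_iff₀ (lt_max_of_lt_right hs) (lt_max_of_lt_right (hs.trans_le hst)),
      mul_max_of_nonneg _ _ hs.le, mul_max_of_nonneg _ _ (hs.le.trans hst)]
    exact max_le_max (mul_le_mul_of_nonneg_right hst ha) (mul_comm s t).le

lemma exists_gauge_of_zero_imp_zero {X : Type*} [TopologicalSpace X] [CompactSpace X]
    {g₁ g₂ : X → ℝ} (hg₁ : Continuous g₁) (hg₂ : Continuous g₂)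
    (hg₁0 : ∀ x, 0 ≤ g₁ x) (hg₂0 : ∀ x, 0 ≤ g₂ x) (hzero : ∀ x, g₂ x = 0 → g₁ x = 0) :
    ∃ θ : ℝ → ℝ, Continuous θ ∧ StrictMonoOn θ (Set.Ici 0) ∧ θ 0 = 0 ∧
      (∀ s, 0 ≤ s → 0 ≤ θ s) ∧ ∀ x, g₁ x ≤ θ (g₂ x) := by
  have hcont := continuous_mul_abs_div_max hg₁ hg₂ hg₂0 hzero
  have hbdd (s : ℝ) : BddAbove (Set.range fun x => g₁ x * (|s| / max (g₂ x) |s|)) :=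
    (isCompact_range (hcont.comp (Continuous.prodMk_right s))).bddAbove
  have hnonneg (s : ℝ) : 0 ≤ ⨆ x, g₁ x * (|s| / max (g₂ x) |s|) :=
    Real.iSup_nonneg fun x => mul_nonneg (hg₁0 x)
      (div_nonneg (abs_nonneg _) (le_max_of_le_left (hg₂0 x)))
  refine ⟨fun s => s + ⨆ x, g₁ x * (|s| / max (g₂ x) |s|), ?_, ?_, ?_, ?_, ?_⟩
  · refine continuous_id.add ?_
    have h := isCompact_univ.continuous_sSup
      (f := fun (s : ℝ) (x : X) => g₁ x * (|s| / max (g₂ x) |s|)) hcont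
    simpa only [Set.image_univ, sSup_range] using h
  · intro s hs t ht hst
    refine add_lt_add_of_lt_of_le hst (ciSup_mono (hbdd t) fun x => ?_)
    rw [abs_of_nonneg hs, abs_of_nonneg ht]
    exact mul_le_mul_of_nonneg_left (div_max_le_div_max (hg₂0 x) hs hst.le) (hg₁0 x)
  · simp
  · exact fun s hs => add_nonneg hs (hnonneg s)
  · intro x
    by_cases hx : g₂ x = 0
    · rw [hzero x hx]
      exact add_nonneg (hg₂0 x) (hnonneg _)
    · refine le_add_of_nonneg_of_le (hg₂0 x) (le_trans ?_ (le_ciSup (hbdd (g₂ x)) x))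
      simp [abs_of_nonneg (hg₂0 x), hx]

/-- Renormalization lemma: for two nonnegative continuous functions `g₁, g₂` on a
compact set `K ⊆ ℝⁿ` whose zero sets are nested (`{g₂ = 0} ⊆ {g₁ = 0}`), there is a
continuous strictly increasing gauge `θ : [0,∞) → [0,∞)` with `θ 0 = 0` and
`g₁ ≤ θ ∘ g₂` on `K`. -/
theorem stmt_0 {n : ℕ} (K : Set (EuclideanSpace ℝ (Fin n))) (hK : IsCompact K)
    (g₁ g₂ : EuclideanSpace ℝ (Fin n) → ℝ)
    (hg₁ : ContinuousOn g₁ K) (hg₂ : ContinuousOn g₂ K)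
    (hg₁0 : ∀ x ∈ K, 0 ≤ g₁ x) (hg₂0 : ∀ x ∈ K, 0 ≤ g₂ x)
    (hzero : {x ∈ K | g₂ x = 0} ⊆ {x ∈ K | g₁ x = 0}) :
    ∃ θ : ℝ → ℝ, ContinuousOn θ (Set.Ici 0) ∧ StrictMonoOn θ (Set.Ici 0) ∧
      θ 0 = 0 ∧ (∀ σ ∈ Set.Ici (0:ℝ), 0 ≤ θ σ) ∧ ∀ x ∈ K, g₁ x ≤ θ (g₂ x) := by
  have : CompactSpace K := isCompact_iff_compactSpace.1 hK
  obtain ⟨θ, hcont, hmono, hθ0, hnonneg, hle⟩ := exists_gauge_of_zero_imp_zero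
    hg₁.domRestrict hg₂.domRestrict (fun x => hg₁0 x x.2) (fun x => hg₂0 x x.2)
    (fun x hx => (hzero ⟨x.2, hx⟩).2)
  exact ⟨θ, hcont.continuousOn, hmono, hθ0, hnonneg, fun x hx => hle ⟨x, hx⟩⟩
end

section
/- Let K be a compact subset of ℝⁿ and let g₁, g₂ : K → ℝ be nonnegative continuous functions such that {x ∈ K : g₂(x) = 0} ⊆ {x ∈ K : g₁(x) = 0}. For σ ≥ 0 define θ̃(σ) = sup{g₁(z) : z ∈ K, g₂(z) ≤ σ} (with the convention that the supremum over the empty set is 0). Then: (i) θ̃ is nondecreasing on [0,∞); (ii) g₁(x) ≤ θ̃(g₂(x)) for every x ∈ K; and (iii) θ̃(σ) → 0 as σ → 0⁺. -/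
/-- On a compact set, if a nonnegative continuous function `g` vanishes only where the
continuous function `f` is nonpositive, then `f` is small wherever `g` is small. -/
theorem IsCompact.exists_pos_forall_lt_of_forall_eq_zero {X : Type*} [TopologicalSpace X]
    [T2Space X] {K : Set X} (hK : IsCompact K) {f g : X → ℝ} (hf : ContinuousOn f K)
    (hg : ContinuousOn g K) (hg0 : ∀ x ∈ K, 0 ≤ g x) (hfg : ∀ x ∈ K, g x = 0 → f x ≤ 0)
    {ε : ℝ} (hε : 0 < ε) : ∃ δ > 0, ∀ x ∈ K, g x < δ → f x < ε := by
  have hC : IsCompact (K ∩ f ⁻¹' Set.Ici ε) :=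
    hK.of_isClosed_subset (hf.preimage_isClosed_of_isClosed hK.isClosed isClosed_Ici)
      Set.inter_subset_left
  have hpos : ∀ x ∈ K ∩ f ⁻¹' Set.Ici ε, 0 < g x := fun x hx =>
    (hg0 x hx.1).lt_of_ne fun h => (hε.trans_le hx.2).not_ge (hfg x hx.1 h.symm)
  obtain ⟨δ, hδ, hle⟩ := hC.exists_forall_le' (hg.mono Set.inter_subset_left) hpos
  exact ⟨δ, hδ, fun x hx hlt => not_le.1 fun h => (hle x ⟨hx, h⟩).not_gt hlt⟩

/-- Constructive core of the renormalization lemma: the function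
`θ̃ σ = sup {g₁ z | z ∈ K, g₂ z ≤ σ}` (with `sup ∅ = 0`, which is the convention of
`sSup` on `ℝ`) is nondecreasing on `[0,∞)`, dominates `g₁` in terms of `g₂` on `K`,
and tends to `0` as `σ → 0⁺`. -/
theorem stmt_1 {n : ℕ} (K : Set (EuclideanSpace ℝ (Fin n))) (hK : IsCompact K)
    (g₁ g₂ : EuclideanSpace ℝ (Fin n) → ℝ)
    (hg₁ : ContinuousOn g₁ K) (hg₂ : ContinuousOn g₂ K)
    (hg₁0 : ∀ x ∈ K, 0 ≤ g₁ x) (hg₂0 : ∀ x ∈ K, 0 ≤ g₂ x)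
    (hzero : {x ∈ K | g₂ x = 0} ⊆ {x ∈ K | g₁ x = 0})
    (θt : ℝ → ℝ)
    (hθt : ∀ σ : ℝ, θt σ = sSup (g₁ '' {z ∈ K | g₂ z ≤ σ})) :
    MonotoneOn θt (Set.Ici 0) ∧
    (∀ x ∈ K, g₁ x ≤ θt (g₂ x)) ∧
    Filter.Tendsto θt (nhdsWithin 0 (Set.Ioi 0)) (nhds 0) := by
  have hbdd (σ : ℝ) : BddAbove (g₁ '' {z ∈ K | g₂ z ≤ σ}) :=
    (hK.bddAbove_image hg₁).mono (Set.image_mono (Set.sep_subset _ _))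
  have hnonneg (σ : ℝ) : 0 ≤ θt σ := by
    rw [hθt]
    exact Real.sSup_nonneg (Set.forall_mem_image.2 fun z hz => hg₁0 z hz.1)
  refine ⟨fun σ _ τ _ hστ => ?_, fun x hx => ?_, ?_⟩
  · rw [hθt σ]
    exact Real.sSup_le (Set.forall_mem_image.2 fun z hz => hθt τ ▸
      le_csSup (hbdd τ) (Set.mem_image_of_mem g₁ ⟨hz.1, hz.2.trans hστ⟩)) (hnonneg τ)
  · rw [hθt]
    exact le_csSup (hbdd _) (Set.mem_image_of_mem g₁ ⟨hx, le_rfl⟩)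
  · refine tendsto_order.2 ⟨fun a ha => .of_forall fun σ => ha.trans_le (hnonneg σ),
      fun ε hε => ?_⟩
    obtain ⟨δ, hδ, hlt⟩ := hK.exists_pos_forall_lt_of_forall_eq_zero hg₁ hg₂ hg₂0
      (fun x hx h => (hzero ⟨hx, h⟩).2.le) (half_pos hε)
    filter_upwards [Ioo_mem_nhdsGT hδ] with σ hσ
    rw [hθt]
    exact (Real.sSup_le (Set.forall_mem_image.2 fun z hz =>
      (hlt z hz.1 (hz.2.trans_lt hσ.2)).le) (half_pos hε).le).trans_lt (half_lt_self hε)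
end

section
/- Let n ≥ 1, let a < t₀ < b, and let M : (a,b) → Mat_{n×n}(ℝ) be differentiable with M′(t) = −M(t)² for every t ∈ (a,b). Suppose v ∈ ℝⁿ with v ≠ 0 and λ ∈ ℝ satisfy M(t₀)v = λv. Then for every t ∈ (a,b) one has 1 + (t − t₀)λ > 0 and M(t)v = (λ / (1 + (t − t₀)λ)) v. In particular, the eigenvectors of M(t) can be chosen independently of t, and each eigenvalue λ of M(t₀) evolves as λ/(1 + (t − t₀)λ). -/
/-- A solution of a linear ODE with continuous coefficients that vanishes at one point of an open
interval vanishes on the whole interval. -/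
theorem eq_zero_of_hasDerivAt_linear {E : Type*} [NormedAddCommGroup E] [NormedSpace ℝ E]
    {a b t₀ : ℝ} (ht₀ : t₀ ∈ Set.Ioo a b) {A : ℝ → E →L[ℝ] E}
    (hA : ContinuousOn A (Set.Ioo a b)) {w : ℝ → E}
    (hw : ∀ t ∈ Set.Ioo a b, HasDerivAt w (A t (w t)) t) (hw₀ : w t₀ = 0) :
    ∀ t ∈ Set.Ioo a b, w t = 0 := by
  intro t ht
  obtain ⟨c, hac, hc⟩ := exists_between (lt_min ht₀.1 ht.1)
  obtain ⟨d, hd, hdb⟩ := exists_between (max_lt ht₀.2 ht.2)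
  rw [lt_min_iff] at hc
  rw [max_lt_iff] at hd
  have hsub : Set.Icc c d ⊆ Set.Ioo a b := Set.Icc_subset_Ioo hac hdb
  obtain ⟨K, hK⟩ := isCompact_Icc.exists_bound_of_continuousOn (hA.mono hsub)
  refine ODE_solution_unique_of_mem_Ioo (v := fun s x => A s x) (s := fun _ => Set.univ)
    (K := K.toNNReal) (g := fun _ => 0) (fun s hs => ?_) ⟨hc.1, hd.1⟩
    (fun s hs => ⟨hw s (hsub (Set.Ioo_subset_Icc_self hs)), Set.mem_univ _⟩)
    (fun s _ => ⟨?_, Set.mem_univ _⟩) hw₀ ⟨hc.2, hd.2⟩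
  · refine ((A s).lipschitz.weaken ?_).lipschitzOnWith
    exact NNReal.le_toNNReal_of_coe_le (hK s (Set.Ioo_subset_Icc_self hs))
  · simpa using hasDerivAt_const s (0 : E)

/-- Along a solution of `M′ = −M²`, an eigenvector `v` of `M t₀` with eigenvalue `λ` satisfies
`(1 + (t − t₀)λ) M(t) v = λ v`. -/
theorem riccati_smul_mulVec_eq {ι : Type*} [Fintype ι] [DecidableEq ι] {a b t₀ : ℝ}
    (ht₀ : t₀ ∈ Set.Ioo a b) {M : ℝ → Matrix ι ι ℝ}
    (hM : ∀ t ∈ Set.Ioo a b, ∀ i j,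
      HasDerivAt (fun s => M s i j) ((-(M t * M t)) i j) t)
    {v : ι → ℝ} {lam : ℝ} (heig : (M t₀).mulVec v = lam • v) :
    ∀ t ∈ Set.Ioo a b, (1 + (t - t₀) * lam) • (M t).mulVec v = lam • v := by
  let L : Matrix ι ι ℝ →ₗ[ℝ] ((ι → ℝ) →L[ℝ] (ι → ℝ)) :=
    LinearMap.toContinuousLinearMap.toLinearMap ∘ₗ (Matrix.toLin' (R := ℝ)).toLinearMap
  have hL (B : Matrix ι ι ℝ) (x : ι → ℝ) : L B x = B.mulVec x := rfl
  have hMc : ContinuousOn M (Set.Ioo a b) := continuousOn_pi.2 fun i => continuousOn_pi.2 fun j =>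
    fun t ht => (hM t ht i j).continuousAt.continuousWithinAt
  have hA : ContinuousOn (fun t => -L (M t)) (Set.Ioo a b) :=
    (L.continuous_of_finiteDimensional.comp_continuousOn hMc).neg
  have hmul (t : ℝ) (ht : t ∈ Set.Ioo a b) :
      HasDerivAt (fun s => (M s).mulVec v) ((-(M t * M t)).mulVec v) t :=
    hasDerivAt_pi.2 fun i => HasDerivAt.fun_sum fun j _ => (hM t ht i j).mul_const (v j)
  have hw := eq_zero_of_hasDerivAt_linear ht₀ hA
    (w := fun t => (1 + (t - t₀) * lam) • (M t).mulVec v - lam • v) (fun t ht => ?_)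
    (by simp [heig])
  · exact fun t ht => sub_eq_zero.1 (hw t ht)
  · have hφ : HasDerivAt (fun s : ℝ => 1 + (s - t₀) * lam) lam t := by
      simpa using (((hasDerivAt_id t).sub_const t₀).mul_const lam).const_add 1
    convert (hφ.fun_smul (hmul t ht)).sub_const (lam • v) using 1
    simp only [neg_apply, hL, Matrix.mulVec_sub, Matrix.mulVec_smul,
      Matrix.neg_mulVec, Matrix.mulVec_mulVec]
    module


/-- Matrix Riccati equation `M′ = −M²`: eigenvectors are preserved in time, and an
eigenvalue `λ` of `M t₀` evolves as `λ / (1 + (t − t₀)λ)`, which stays finite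
(`1 + (t − t₀)λ > 0`) on the whole interval of existence `(a,b)`. -/
theorem stmt_2 {n : ℕ} (hn : 1 ≤ n) {a b t₀ : ℝ} (ha : a < t₀) (hb : t₀ < b)
    (M : ℝ → Matrix (Fin n) (Fin n) ℝ)
    (hM : ∀ t ∈ Set.Ioo a b, ∀ i j,
      HasDerivAt (fun s => M s i j) ((-(M t * M t)) i j) t)
    (v : Fin n → ℝ) (hv : v ≠ 0) (lam : ℝ)
    (heig : (M t₀).mulVec v = lam • v) :
    ∀ t ∈ Set.Ioo a b, 0 < 1 + (t - t₀) * lam ∧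
      (M t).mulVec v = (lam / (1 + (t - t₀) * lam)) • v := by
  have ht₀ : t₀ ∈ Set.Ioo a b := ⟨ha, hb⟩
  have key := riccati_smul_mulVec_eq ht₀ hM heig
  have hne : ∀ t ∈ Set.Ioo a b, 1 + (t - t₀) * lam ≠ 0 := by
    intro t ht h0
    have h := key t ht
    rw [h0, zero_smul, eq_comm, smul_eq_zero_iff_left hv] at h
    simp [h] at h0
  intro t ht
  have hpos : 0 < 1 + (t - t₀) * lam := by
    by_contra! hle
    have hcont : ContinuousOn (fun s : ℝ => 1 + (s - t₀) * lam) (Set.Ioo a b) := by fun_prop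
    obtain ⟨s, hs, hs0⟩ := isPreconnected_Ioo.intermediate_value ht ht₀ hcont
      (show (0 : ℝ) ∈ Set.Icc _ _ by simpa using hle)
    exact hne s hs hs0
  refine ⟨hpos, ?_⟩
  rw [div_eq_inv_mul, mul_smul, ← key t ht, inv_smul_smul₀ hpos.ne']
end
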